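/- Fix σ ∈ {0,1}. Let H and h be smooth time-dependent forms on ℝ⁹ of degrees 3 and 2, and for each integer k with 1 ≤ k ≤ 9 and k ≡ σ (mod 2) let B_k and e_{k−1} be smooth time-dependent forms on ℝ⁹ of degrees k and k−1; set B_k := 0 and e_{k−1} := 0 for all other integers k. Assume the duality-symmetric NS/RR evolution equations hold at every point of ℝ × ℝ⁹: ∂_tH = dh and, for every k, ∂_tB_k = d e_{k−1} + h ∧ B_{k−2} − H ∧ e_{k−3}. If the Gauß laws hold on the Cauchy surface {t = 0}, i.e. dH(0,·) = 0 and dB_k(0,·) = (H ∧ B_{k−2})(0,·) for all k, then they hold on all of ℝ × ℝ⁹: dH(t,·) = 0 and dB_k(t,·) = (H ∧ B_{k−2})(t,·) for all t and all k. (Lemma 2.1 of the paper for the NS/RR-fields of 10d type II supergravity in democratic form, whose Gauß laws are the H₃-twisted Bianchi identities d B_k = H₃ ∧ B_{k−2} underlying flux quantization in twisted K-theory, §3.3.) -/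

import Mathlib

open scoped BigOperators

/-- The spatial model space `ℝ^d`. -/
abbrev Vec (d : ℕ) : Type := Fin d → ℝ

/-- The space of alternating `p`-linear maps `(ℝ^d)^p → ℝ`. -/
abbrev AltForm (d p : ℕ) : Type := AlternatingMap ℝ (Vec d) ℝ (Fin p)

/-- A time-dependent `p`-form on `ℝ^d`: a map `ℝ × ℝ^d → (ℝ^d [⋀^p]→ ℝ)`. -/
abbrev TForm (d p : ℕ) : Type := ℝ × Vec d → AltForm d p

/-- A "raw" time-dependent `p`-form: a point of `ℝ × ℝ^d` together with a `p`-tuple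
of vectors is assigned a number. -/
abbrev RawForm (d p : ℕ) : Type := ℝ × Vec d → (Fin p → Vec d) → ℝ

/-- The raw form underlying a time-dependent `p`-form. -/
def TForm.raw {d p : ℕ} (ω : TForm d p) : RawForm d p := fun q v => ω q v

/-- A time-dependent `p`-form is smooth iff all its evaluations (at `p`-tuples of vectors,
which are linear coordinates on the finite-dimensional space of alternating `p`-linear maps)
are smooth functions of `(t, x)`. -/
def TForm.Smooth {d p : ℕ} (ω : TForm d p) : Prop :=
  ∀ v : Fin p → Vec d, ContDiff ℝ (⊤ : ℕ∞) fun q : ℝ × Vec d => ω q v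

/-- The time derivative `∂ₜω` of a (raw) time-dependent form, evaluation-wise. -/
noncomputable def tder {d p : ℕ} (ω : RawForm d p) : RawForm d p :=
  fun q v => deriv (fun s : ℝ => ω (s, q.2) v) q.1

/-- The spatial exterior derivative `dω` of a (raw) time-dependent `p`-form:
`(dω)(t,x)(v₀,…,v_p) = ∑ i, (-1)^i (D_x ω(t,·)(x) vᵢ)(v₀,…,v̂ᵢ,…,v_p)`. -/
noncomputable def sder {d p : ℕ} (ω : RawForm d p) : RawForm d (p + 1) :=
  fun q v => ∑ i : Fin (p + 1),
    (-1 : ℝ) ^ (i : ℕ) *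
      fderiv ℝ (fun x : Vec d => ω (q.1, x) (v ∘ i.succAbove)) q.2 (v i)

/-- The wedge product of alternating maps (the alternatization of the tensor product,
with the `(p+q)!/(p!q!)` normalization, i.e. without division). -/
noncomputable def wedge {V : Type*} [AddCommGroup V] [Module ℝ V] {p q : ℕ}
    (α : AlternatingMap ℝ V ℝ (Fin p)) (β : AlternatingMap ℝ V ℝ (Fin q)) :
    AlternatingMap ℝ V ℝ (Fin (p + q)) :=
  ((LinearMap.mul' ℝ ℝ).compAlternatingMap (α.domCoprod β)).domDomCongr finSumFinEquiv


open Equiv in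
theorem wedge_apply {V : Type*} [AddCommGroup V] [Module ℝ V] {p q : ℕ}
    (α : AlternatingMap ℝ V ℝ (Fin p)) (β : AlternatingMap ℝ V ℝ (Fin q)) (v : Fin (p + q) → V) :
    wedge α β v = ((p.factorial * q.factorial : ℕ) : ℝ)⁻¹ * ∑ σ : Perm (Fin (p + q)),
      ((Perm.sign σ : ℤ) : ℝ) *
        (α (fun i => v (σ (Fin.castAdd q i))) * β (fun i => v (σ (Fin.natAdd p i)))) := by
  have hne : ((p.factorial * q.factorial : ℕ) : ℝ) ≠ 0 := by positivity
  rw [eq_inv_mul_iff_mul_eq₀ hne]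
  have key := congrArg (fun f => LinearMap.mul' ℝ ℝ (f (v ∘ finSumFinEquiv)))
    (MultilinearMap.domCoprod_alternization_eq α β)
  rw [AlternatingMap.smul_apply, map_nsmul, nsmul_eq_mul,
    MultilinearMap.alternatization_apply, map_sum, Fintype.card_fin, Fintype.card_fin] at key
  refine key.symm.trans ?_
  refine Fintype.sum_equiv (finSumFinEquiv.permCongr) _ _ fun σ => ?_
  rw [Perm.sign_permCongr, Units.smul_def, map_zsmul, zsmul_eq_mul]
  simp [MultilinearMap.domDomCongr_apply, Function.comp_def]

section WedgeTo

open Equiv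

variable {V : Type*} [AddCommGroup V] [Module ℝ V] {p q r n : ℕ}

/-- The wedge product as a bilinear map into alternating maps of degree `n = p + q`. -/
noncomputable def wedgeTo (h : p + q = n) :
    AlternatingMap ℝ V ℝ (Fin p) →ₗ[ℝ] AlternatingMap ℝ V ℝ (Fin q) →ₗ[ℝ]
      AlternatingMap ℝ V ℝ (Fin n) :=
  LinearMap.mk₂ ℝ (fun α β => (wedge α β).domDomCongr (finCongr h))
    (fun α α' β => by
      ext v
      simp [wedge_apply, add_mul, mul_add, Finset.sum_add_distrib])
    (fun c α β => by
      ext v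
      simp only [AlternatingMap.domDomCongr_apply, AlternatingMap.smul_apply, wedge_apply,
        smul_eq_mul, Finset.mul_sum]
      exact Finset.sum_congr rfl fun _ _ => by ring)
    (fun α β β' => by
      ext v
      simp [wedge_apply, mul_add, Finset.sum_add_distrib])
    (fun c α β => by
      ext v
      simp only [AlternatingMap.domDomCongr_apply, AlternatingMap.smul_apply, wedge_apply,
        smul_eq_mul, Finset.mul_sum]
      exact Finset.sum_congr rfl fun _ _ => by ring)

theorem wedgeTo_apply (h : p + q = n) (α : AlternatingMap ℝ V ℝ (Fin p))
    (β : AlternatingMap ℝ V ℝ (Fin q)) (v : Fin n → V) :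
    wedgeTo h α β v = ((p.factorial * q.factorial : ℕ) : ℝ)⁻¹ * ∑ σ : Perm (Fin n),
      ((Perm.sign σ : ℤ) : ℝ) * (α (fun i => v (σ (Fin.cast h (Fin.castAdd q i)))) *
        β (fun i => v (σ (Fin.cast h (Fin.natAdd p i))))) := by
  subst h
  exact wedge_apply α β v

theorem wedgeTo_comm (h : p + q = n) (h' : q + p = n) (α : AlternatingMap ℝ V ℝ (Fin p))
    (β : AlternatingMap ℝ V ℝ (Fin q)) :
    wedgeTo h α β = ((Perm.sign
      (((finCongr h.symm).trans finAddFlip).trans (finCongr h')) : ℤ) : ℝ) •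
        wedgeTo h' β α := by
  ext v
  simp only [AlternatingMap.smul_apply, wedgeTo_apply, smul_eq_mul, Finset.mul_sum]
  set ρ : Perm (Fin n) := ((finCongr h.symm).trans finAddFlip).trans (finCongr h') with hρ
  refine Fintype.sum_equiv (Equiv.mulRight ρ⁻¹) _ _ fun σ => ?_
  have h1 : ∀ i : Fin p, ρ⁻¹ (Fin.cast h' (Fin.natAdd q i)) = Fin.cast h (Fin.castAdd q i) := by
    intro i
    rw [Perm.inv_eq_iff_eq]
    simp [hρ]
  have h2 : ∀ i : Fin q, ρ⁻¹ (Fin.cast h' (Fin.castAdd p i)) = Fin.cast h (Fin.natAdd p i) := by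
    intro i
    rw [Perm.inv_eq_iff_eq]
    simp [hρ]
  have hs : (((Perm.sign ρ : ℤ) : ℝ)) * ((Perm.sign ρ : ℤ) : ℝ) = 1 := by
    rw [← Int.cast_mul, Int.units_coe_mul_self, Int.cast_one]
  simp only [Equiv.coe_mulRight, Perm.mul_apply, h1, h2, Perm.sign_mul, Perm.sign_inv,
    Units.val_mul, Int.cast_mul, Nat.cast_mul]
  linear_combination (-(((p.factorial : ℝ) * q.factorial)⁻¹ * ((Perm.sign σ : ℤ) : ℝ) *
    (α (fun i => v (σ (Fin.cast h (Fin.castAdd q i)))) *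
        β (fun i => v (σ (Fin.cast h (Fin.natAdd p i))))))) * hs

theorem sum_perm_eq_average {m : ℕ} (F : Perm (Fin n) → ℝ) (g : Perm (Fin m) → Perm (Fin n)) :
    ∑ σ, F σ = (m.factorial : ℝ)⁻¹ * ∑ τ, ∑ σ, F (σ * g τ) := by
  have hm : (m.factorial : ℝ) ≠ 0 := by positivity
  have hτ : ∀ τ, ∑ σ, F (σ * g τ) = ∑ σ, F σ :=
    fun τ => Fintype.sum_equiv (Equiv.mulRight (g τ)) _ _ fun σ => rfl
  simp [hτ, Fintype.card_perm, hm]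

theorem wedgeTo_assoc {m l : ℕ} (h₁ : p + q = m) (h₂ : m + r = n) (h₃ : q + r = l)
    (h₄ : p + l = n) (α : AlternatingMap ℝ V ℝ (Fin p)) (β : AlternatingMap ℝ V ℝ (Fin q))
    (γ : AlternatingMap ℝ V ℝ (Fin r)) :
    wedgeTo h₂ (wedgeTo h₁ α β) γ = wedgeTo h₄ α (wedgeTo h₃ β γ) := by
  have hl : ∀ v : Fin n → V, wedgeTo h₂ (wedgeTo h₁ α β) γ v =
      ((p.factorial * q.factorial * r.factorial : ℕ) : ℝ)⁻¹ * ∑ σ : Perm (Fin n),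
      ((Perm.sign σ : ℤ) : ℝ) *
        (α (fun i => v (σ (Fin.cast h₂ (Fin.castAdd r (Fin.cast h₁ (Fin.castAdd q i)))))) *
         β (fun i => v (σ (Fin.cast h₂ (Fin.castAdd r (Fin.cast h₁ (Fin.natAdd p i)))))) *
         γ (fun i => v (σ (Fin.cast h₂ (Fin.natAdd m i))))) := by
    intro v
    set F : Perm (Fin n) → ℝ := fun σ => ((Perm.sign σ : ℤ) : ℝ) *
        (α (fun i => v (σ (Fin.cast h₂ (Fin.castAdd r (Fin.cast h₁ (Fin.castAdd q i)))))) *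
         β (fun i => v (σ (Fin.cast h₂ (Fin.castAdd r (Fin.cast h₁ (Fin.natAdd p i)))))) *
         γ (fun i => v (σ (Fin.cast h₂ (Fin.natAdd m i))))) with hF
    let ext' : Perm (Fin m) → Perm (Fin n) := fun τ =>
      (finSumFinEquiv.trans (finCongr h₂)).permCongr (Equiv.sumCongr τ (1 : Perm (Fin r)))
    have e1 : ∀ τ i, ext' τ (Fin.cast h₂ (Fin.castAdd r i)) =
        Fin.cast h₂ (Fin.castAdd r (τ i)) := by
      intro τ i
      simp [ext', Equiv.permCongr_apply]
    have e2 : ∀ τ i, ext' τ (Fin.cast h₂ (Fin.natAdd m i)) =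
        Fin.cast h₂ (Fin.natAdd m i) := by
      intro τ i
      simp [ext', Equiv.permCongr_apply]
    have e3 : ∀ τ, Perm.sign (ext' τ) = Perm.sign τ := by
      intro τ
      simp [ext', Perm.sign_permCongr]
    rw [sum_perm_eq_average F ext', wedgeTo_apply, Finset.sum_comm, Finset.mul_sum,
      Finset.mul_sum, Finset.mul_sum]
    refine Finset.sum_congr rfl fun σ _ => ?_
    rw [wedgeTo_apply]
    simp only [Finset.mul_sum, Finset.sum_mul]
    refine Finset.sum_congr rfl fun τ _ => ?_
    simp only [hF, Perm.mul_apply, e1, e2, e3, Perm.sign_mul, Units.val_mul, Int.cast_mul,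
      Nat.cast_mul, mul_inv]
    ring
  have hr : ∀ v : Fin n → V, wedgeTo h₄ α (wedgeTo h₃ β γ) v =
      ((p.factorial * q.factorial * r.factorial : ℕ) : ℝ)⁻¹ * ∑ σ : Perm (Fin n),
      ((Perm.sign σ : ℤ) : ℝ) *
        (α (fun i => v (σ (Fin.cast h₄ (Fin.castAdd l i)))) *
         β (fun i => v (σ (Fin.cast h₄ (Fin.natAdd p (Fin.cast h₃ (Fin.castAdd r i)))))) *
         γ (fun i => v (σ (Fin.cast h₄ (Fin.natAdd p (Fin.cast h₃ (Fin.natAdd q i))))))) := by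
    intro v
    set F : Perm (Fin n) → ℝ := fun σ => ((Perm.sign σ : ℤ) : ℝ) *
        (α (fun i => v (σ (Fin.cast h₄ (Fin.castAdd l i)))) *
         β (fun i => v (σ (Fin.cast h₄ (Fin.natAdd p (Fin.cast h₃ (Fin.castAdd r i)))))) *
         γ (fun i => v (σ (Fin.cast h₄ (Fin.natAdd p (Fin.cast h₃ (Fin.natAdd q i))))))) with hF
    let ext' : Perm (Fin l) → Perm (Fin n) := fun τ =>
      (finSumFinEquiv.trans (finCongr h₄)).permCongr (Equiv.sumCongr (1 : Perm (Fin p)) τ)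
    have e1 : ∀ τ i, ext' τ (Fin.cast h₄ (Fin.castAdd l i)) =
        Fin.cast h₄ (Fin.castAdd l i) := by
      intro τ i
      simp [ext', Equiv.permCongr_apply]
    have e2 : ∀ τ i, ext' τ (Fin.cast h₄ (Fin.natAdd p i)) =
        Fin.cast h₄ (Fin.natAdd p (τ i)) := by
      intro τ i
      simp [ext', Equiv.permCongr_apply]
    have e3 : ∀ τ, Perm.sign (ext' τ) = Perm.sign τ := by
      intro τ
      simp [ext', Perm.sign_permCongr]
    rw [sum_perm_eq_average F ext', wedgeTo_apply, Finset.sum_comm, Finset.mul_sum,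
      Finset.mul_sum, Finset.mul_sum]
    refine Finset.sum_congr rfl fun σ _ => ?_
    rw [wedgeTo_apply]
    simp only [Finset.mul_sum]
    refine Finset.sum_congr rfl fun τ _ => ?_
    simp only [hF, Perm.mul_apply, e1, e2, e3, Perm.sign_mul, Units.val_mul, Int.cast_mul,
      Nat.cast_mul, mul_inv]
    ring
  ext v
  rw [hl, hr]
  subst h₁ h₃ h₂
  refine congrArg _ (Finset.sum_congr rfl fun σ _ => ?_)
  congr 4
  · ext i
    congr 2
    ext
    simp [add_assoc]

theorem wedgeTo_one_left_comm (h : 1 + p = n) (h' : p + 1 = n)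
    (α : AlternatingMap ℝ V ℝ (Fin 1)) (β : AlternatingMap ℝ V ℝ (Fin p)) :
    wedgeTo h α β = (-1 : ℝ) ^ p • wedgeTo h' β α := by
  subst h'
  have hρ : ((finCongr h.symm).trans finAddFlip).trans (finCongr rfl) = (finRotate (p + 1))⁻¹ := by
    rw [eq_inv_iff_mul_eq_one]
    ext i
    induction i using Fin.lastCases with
    | last =>
      have : finRotate (p + 1) (Fin.last p) = Fin.cast h (Fin.castAdd p 0) := by
        rw [finRotate_last]
        rfl
      simp [this]
    | cast i =>
      have : finRotate (p + 1) i.castSucc = Fin.cast h (Fin.natAdd 1 i) := by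
        ext
        simp
      simp only [Perm.mul_apply, this, Equiv.trans_apply, finCongr_apply, Fin.cast_cast,
        Fin.cast_eq_self, finAddFlip_apply_natAdd]
      simp
  rw [wedgeTo_comm h rfl, hρ, Perm.sign_inv, sign_finRotate]
  simp

theorem wedgeTo_one_left_apply (h : 1 + p = p + 1) (a : AlternatingMap ℝ V ℝ (Fin 1))
    (β : AlternatingMap ℝ V ℝ (Fin p)) (v : Fin (p + 1) → V) :
    wedgeTo h a β v = ∑ i : Fin (p + 1), (-1 : ℝ) ^ (i : ℕ) *
      (a (fun _ => v i) * β (v ∘ i.succAbove)) := by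
  have hp : (p.factorial : ℝ) ≠ 0 := by positivity
  rw [wedgeTo_apply, ← Perm.decomposeFin.symm.sum_comp, Fintype.sum_prod_type, Finset.mul_sum]
  refine Finset.sum_congr rfl fun i _ => ?_
  have c0 : ∀ j : Fin 1, Fin.cast h (Fin.castAdd p j) = 0 := by
    intro j
    ext
    simp
  have c1 : ∀ j : Fin p, Fin.cast h (Fin.natAdd 1 j) = j.succ := by
    intro j
    ext
    simp
  simp only [c0, c1, Perm.decomposeFin_symm_apply_zero, Perm.decomposeFin_symm_apply_succ,
    Perm.decomposeFin.symm_sign]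
  have hβ : ∀ e : Perm (Fin p), β (fun j => v (swap 0 i (e j).succ)) =
      ((Perm.sign e : ℤ) : ℝ) * β (fun j => v (swap 0 i j.succ)) := by
    intro e
    have := β.map_perm (fun j => v (swap 0 i j.succ)) e
    rw [Units.smul_def, zsmul_eq_mul] at this
    exact this
  have hi : (((if i = 0 then (1 : ℤˣ) else -1 : ℤˣ) : ℤ) : ℝ) * β (fun j => v (swap 0 i j.succ)) =
      (-1) ^ (i : ℕ) * β (v ∘ i.succAbove) := by
    induction i using Fin.cases with
    | zero => simp [Function.comp_def]
    | succ k =>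
      have := β.map_perm (v ∘ k.succ.succAbove) k.cycleRange
      rw [Fin.sign_cycleRange, Units.smul_def, zsmul_eq_mul] at this
      simp only [Function.comp_def, Fin.succAbove_cycleRange] at this
      simp [this, pow_succ, Function.comp_def]
  have hs : ∀ e : Perm (Fin p), (((Perm.sign e : ℤ) : ℝ)) * ((Perm.sign e : ℤ) : ℝ) = 1 := by
    intro e
    rw [← Int.cast_mul, Int.units_coe_mul_self, Int.cast_one]
  have hsum : ∀ e : Perm (Fin p),
      ((((if i = 0 then (1 : ℤˣ) else -1) * Perm.sign e : ℤˣ) : ℤ) : ℝ) *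
        (a (fun _ => v i) * β (fun j => v (swap 0 i (e j).succ))) =
      (-1) ^ (i : ℕ) * (a (fun _ => v i) * β (v ∘ i.succAbove)) := by
    intro e
    rw [hβ, Units.val_mul, Int.cast_mul]
    linear_combination a (fun _ => v i) * hi + (((if i = 0 then (1 : ℤˣ) else -1 : ℤˣ) : ℤ) : ℝ)
      * β (fun j => v (swap 0 i j.succ)) * a (fun _ => v i) * hs e
  simp only [hsum, Finset.sum_const, Finset.card_univ, Fintype.card_perm, Fintype.card_fin,
    nsmul_eq_mul, Nat.factorial_one, one_mul]
  rw [inv_mul_cancel_left₀ hp]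

end WedgeTo

section SmoothForms

variable {d p q n : ℕ}

/-- The smooth time-dependent `p`-forms on `ℝ^d`, as a subspace of all time-dependent forms. -/
def smoothForms (d p : ℕ) : Submodule ℝ (TForm d p) where
  carrier := {ω | ω.Smooth}
  add_mem' hα hβ v := (hα v).add (hβ v)
  zero_mem' _ := contDiff_const
  smul_mem' c _ hα v := (hα v).const_smul c

/-- A smooth time-dependent `p`-form on `ℝ^d`. -/
structure SmoothForm (d p : ℕ) where
  /-- The underlying time-dependent form. -/
  val : TForm d p
  smooth : val.Smooth

/-- Smooth forms as elements of the subspace `smoothForms`. -/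
def smoothFormEquiv (d p : ℕ) : SmoothForm d p ≃ smoothForms d p where
  toFun ω := ⟨ω.val, ω.smooth⟩
  invFun ω := ⟨ω.1, ω.2⟩

noncomputable instance : AddCommGroup (SmoothForm d p) := (smoothFormEquiv d p).addCommGroup

noncomputable instance : Module ℝ (SmoothForm d p) := (smoothFormEquiv d p).module ℝ

/-- Evaluation of a smooth form at a point and a tuple of vectors. -/
noncomputable def evalAt (q : ℝ × Vec d) (v : Fin p → Vec d) : SmoothForm d p →ₗ[ℝ] ℝ where
  toFun ω := ω.1 q v
  map_add' _ _ := rfl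
  map_smul' _ _ := rfl

theorem contDiff_eval (ω : SmoothForm d p) (v : Fin p → Vec d) :
    ContDiff ℝ (⊤ : ℕ∞) fun q => ω.1 q v :=
  ω.smooth v

theorem differentiableAt_eval (ω : SmoothForm d p) (v : Fin p → Vec d)
    (q : ℝ × Vec d) : DifferentiableAt ℝ (fun q => ω.1 q v) q :=
  ((contDiff_eval ω v).differentiable (by simp)).differentiableAt

theorem SmoothForm.ext_apply {α β : SmoothForm d p} (h : ∀ q v, α.1 q v = β.1 q v) : α = β :=
  (smoothFormEquiv d p).injective
    (Subtype.ext (funext fun q => AlternatingMap.ext (h q)))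

/-- The derivative of smooth forms in a fixed direction of `ℝ × ℝ^d`. -/
noncomputable def dirDeriv (u : ℝ × Vec d) : SmoothForm d p →ₗ[ℝ] SmoothForm d p where
  toFun ω := ⟨fun q =>
    { toFun := fun v => fderiv ℝ (fun q => ω.1 q v) q u
      map_update_add' := fun v i x y => by
        simp only [AlternatingMap.map_update_add]
        rw [fderiv_fun_add (differentiableAt_eval ω _ q) (differentiableAt_eval ω _ q),
          _root_.add_apply]
      map_update_smul' := fun v i c x => by
        simp only [AlternatingMap.map_update_smul]
        rw [fderiv_fun_const_smul (differentiableAt_eval ω _ q), _root_.smul_apply]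
      map_eq_zero_of_eq' := fun v i j hv hij => by
        simp [fun q => (ω.1 q).map_eq_zero_of_eq v hv hij] },
    fun v => ((contDiff_eval ω v).fderiv_right (by simp)).clm_apply contDiff_const⟩
  map_add' α β := SmoothForm.ext_apply fun q v => by
    change fderiv ℝ (fun q => α.1 q v + β.1 q v) q u = _
    rw [fderiv_fun_add (differentiableAt_eval α _ q) (differentiableAt_eval β _ q)]
    rfl
  map_smul' c α := SmoothForm.ext_apply fun q v => by
    change fderiv ℝ (fun q => c • α.1 q v) q u = _
    rw [fderiv_fun_const_smul (differentiableAt_eval α _ q)]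
    rfl

theorem dirDeriv_apply (u : ℝ × Vec d) (ω : SmoothForm d p) (q : ℝ × Vec d)
    (v : Fin p → Vec d) : (dirDeriv u ω).1 q v = fderiv ℝ (fun q => ω.1 q v) q u := rfl

theorem dirDeriv_comm (u w : ℝ × Vec d) (ω : SmoothForm d p) :
    dirDeriv u (dirDeriv w ω) = dirDeriv w (dirDeriv u ω) := by
  refine SmoothForm.ext_apply fun q v => ?_
  have hle : (2 : WithTop ℕ∞) ≤ ((⊤ : ℕ∞) : WithTop ℕ∞) := WithTop.coe_le_coe.2 (le_top (a := 2))
  have hd : DifferentiableAt ℝ (fderiv ℝ fun q => ω.1 q v) q :=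
    (((contDiff_eval ω v).fderiv_right (m := 1) (one_add_one_eq_two.trans_le hle)).differentiable
      (by simp)).differentiableAt
  have h2 : ∀ a b : ℝ × Vec d, (dirDeriv a (dirDeriv b ω)).1 q v =
      fderiv ℝ (fderiv ℝ fun q => ω.1 q v) q a b := by
    intro a b
    change fderiv ℝ (fun q => fderiv ℝ (fun q => ω.1 q v) q b) q a = _
    rw [fderiv_clm_apply hd (differentiableAt_const b)]
    simp
  rw [h2, h2]
  exact ((contDiff_eval ω v).contDiffAt.isSymmSndFDerivAt (by
    simpa using hle)) u w

/-- The pointwise wedge product of smooth forms. -/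
noncomputable def wedgeForm (h : p + q = n) :
    SmoothForm d p →ₗ[ℝ] SmoothForm d q →ₗ[ℝ] SmoothForm d n :=
  LinearMap.mk₂ ℝ
    (fun α β => ⟨fun x => wedgeTo h (α.1 x) (β.1 x), fun v => by
      simp only [wedgeTo_apply]
      exact contDiff_const.mul (ContDiff.sum fun σ _ =>
        contDiff_const.mul ((contDiff_eval α _).mul (contDiff_eval β _)))⟩)
    (fun _ _ _ => SmoothForm.ext_apply fun _ v =>
      DFunLike.congr_fun ((wedgeTo h).map_add₂ _ _ _) v)
    (fun _ _ _ => SmoothForm.ext_apply fun _ v =>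
      DFunLike.congr_fun ((wedgeTo h).map_smul₂ _ _ _) v)
    (fun _ _ _ => SmoothForm.ext_apply fun _ v =>
      DFunLike.congr_fun ((wedgeTo h _).map_add _ _) v)
    (fun _ _ _ => SmoothForm.ext_apply fun _ v =>
      DFunLike.congr_fun ((wedgeTo h _).map_smul _ _) v)

theorem wedgeForm_assoc {r m l : ℕ} (h₁ : p + q = m) (h₂ : m + r = n) (h₃ : q + r = l)
    (h₄ : p + l = n) (α : SmoothForm d p) (β : SmoothForm d q) (γ : SmoothForm d r) :
    wedgeForm h₂ (wedgeForm h₁ α β) γ = wedgeForm h₄ α (wedgeForm h₃ β γ) :=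
  SmoothForm.ext_apply fun _ v => DFunLike.congr_fun (wedgeTo_assoc h₁ h₂ h₃ h₄ _ _ _) v

theorem wedgeForm_one_left_comm (h : 1 + p = n) (h' : p + 1 = n) (α : SmoothForm d 1)
    (β : SmoothForm d p) : wedgeForm h α β = (-1 : ℝ) ^ p • wedgeForm h' β α :=
  SmoothForm.ext_apply fun _ v => DFunLike.congr_fun (wedgeTo_one_left_comm h h' _ _) v

theorem dirDeriv_wedgeForm (u : ℝ × Vec d) (h : p + q = n) (α : SmoothForm d p)
    (β : SmoothForm d q) :
    dirDeriv u (wedgeForm h α β) =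
      wedgeForm h (dirDeriv u α) β + wedgeForm h α (dirDeriv u β) := by
  refine SmoothForm.ext_apply fun x v => ?_
  have hd := (HasFDerivAt.fun_sum (u := Finset.univ) fun (σ : Equiv.Perm (Fin n)) _ =>
    (((differentiableAt_eval α (fun i => v (σ (Fin.cast h (Fin.castAdd q i)))) x).hasFDerivAt.mul
      (differentiableAt_eval β (fun i => v (σ (Fin.cast h (Fin.natAdd p i))))
        x).hasFDerivAt).const_mul ((Equiv.Perm.sign σ : ℤ) : ℝ))).const_mul
          ((p.factorial * q.factorial : ℕ) : ℝ)⁻¹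
  change fderiv ℝ (fun x => wedgeTo h (α.1 x) (β.1 x) v) x u =
    wedgeTo h ((dirDeriv u α).1 x) (β.1 x) v + wedgeTo h (α.1 x) ((dirDeriv u β).1 x) v
  simp only [wedgeTo_apply]
  erw [hd.fderiv]
  rw [← mul_add, ← Finset.sum_add_distrib]
  simp only [_root_.smul_apply, _root_.sum_apply, _root_.add_apply,
    smul_eq_mul, dirDeriv_apply]
  refine congrArg _ (Finset.sum_congr rfl fun σ _ => ?_)
  ring

/-- The constant coordinate one-form `dx_j`. -/
def coordForm (j : Fin d) : SmoothForm d 1 :=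
  ⟨fun _ => AlternatingMap.ofSubsingleton ℝ (Vec d) ℝ 0 (LinearMap.proj j),
    fun _ => contDiff_const⟩

theorem coordForm_apply (j : Fin d) (q : ℝ × Vec d) (v : Fin 1 → Vec d) :
    (coordForm j).1 q v = v 0 j := rfl

theorem dirDeriv_coordForm (u : ℝ × Vec d) (j : Fin d) : dirDeriv u (coordForm j) = 0 := by
  refine SmoothForm.ext_apply fun q v => ?_
  rw [dirDeriv_apply]
  simp only [coordForm_apply]
  rw [fderiv_fun_const]
  rfl

/-- The spatial exterior derivative of smooth forms. -/
noncomputable def extD : SmoothForm d p →ₗ[ℝ] SmoothForm d (p + 1) :=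
  ∑ j : Fin d, (wedgeForm (add_comm 1 p) (coordForm j)).comp (dirDeriv (0, Pi.single j 1))

theorem extD_eq (ω : SmoothForm d p) :
    extD ω = ∑ j : Fin d, wedgeForm (add_comm 1 p) (coordForm j)
      (dirDeriv (0, Pi.single j 1) ω) := by
  simp [extD]

theorem sder_raw (ω : SmoothForm d p) (q : ℝ × Vec d) (v : Fin (p + 1) → Vec d) :
    sder (TForm.raw ω.1) q v = (extD ω).1 q v := by
  have hR : (extD ω).1 q v = ∑ j : Fin d, wedgeTo (add_comm 1 p) ((coordForm j).1 q)
      ((dirDeriv (0, Pi.single j 1) ω).1 q) v := by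
    rw [extD_eq]
    exact map_sum (evalAt q v) _ _
  have hf : ∀ w (z : Vec d), fderiv ℝ (fun x : Vec d => ω.1 (q.1, x) w) q.2 z =
      ∑ j, z j * (dirDeriv (0, Pi.single j 1) ω).1 q w := by
    intro w z
    have h1 : HasFDerivAt (fun x : Vec d => ω.1 (q.1, x) w)
        ((fderiv ℝ (fun q => ω.1 q w) q).comp (ContinuousLinearMap.inr ℝ ℝ (Vec d))) q.2 :=
      HasFDerivAt.comp (g := fun q => ω.1 q w) (f := fun x => (q.1, x)) q.2
        (differentiableAt_eval ω w q).hasFDerivAt (hasFDerivAt_prodMk_right q.1 q.2)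
    rw [h1.fderiv]
    conv_lhs => rw [pi_eq_sum_univ' z]
    simp [dirDeriv_apply]
  simp only [hR, wedgeTo_one_left_apply, sder, TForm.raw, hf, coordForm_apply]
  rw [Finset.sum_comm]
  refine Finset.sum_congr rfl fun i _ => ?_
  rw [Finset.mul_sum]

theorem tder_raw (ω : SmoothForm d p) (q : ℝ × Vec d) (v : Fin p → Vec d) :
    tder (TForm.raw ω.1) q v = (dirDeriv (1, 0) ω).1 q v := by
  have h1 : HasDerivAt (fun s : ℝ => ω.1 (s, q.2) v)
      (fderiv ℝ (fun q => ω.1 q v) q (1, 0)) q.1 :=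
    HasFDerivAt.comp_hasDerivAt (l := fun q => ω.1 q v) (f := fun s => (s, q.2)) q.1
      (differentiableAt_eval ω v q).hasFDerivAt
      ((hasDerivAt_id q.1).prodMk (hasDerivAt_const q.1 q.2))
  exact h1.deriv

theorem dirDeriv_extD (u : ℝ × Vec d) (ω : SmoothForm d p) :
    dirDeriv u (extD ω) = extD (dirDeriv u ω) := by
  simp [extD_eq, dirDeriv_wedgeForm, dirDeriv_coordForm, dirDeriv_comm u]

theorem eq_zero_of_eq_neg_one_smul {M : Type*} [AddCommGroup M] [Module ℝ M] {x : M}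
    (h : x = (-1 : ℝ) • x) : x = 0 := by
  have h2 : (2 : ℝ) • x = 0 := by
    rw [two_smul]
    nth_rewrite 1 [h]
    simp
  simpa using h2

theorem extD_extD (ω : SmoothForm d p) : extD (extD ω) = 0 := by
  have hS : extD (extD ω) = ∑ i : Fin d, ∑ j : Fin d,
      wedgeForm (by omega : 2 + p = p + 1 + 1)
        (wedgeForm (by omega : 1 + 1 = 2) (coordForm i) (coordForm j))
        (dirDeriv (0, Pi.single i 1) (dirDeriv (0, Pi.single j 1) ω)) := by
    rw [extD_eq (extD ω)]
    refine Finset.sum_congr rfl fun i _ => ?_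
    rw [dirDeriv_extD, extD_eq, map_sum]
    refine Finset.sum_congr rfl fun j _ => ?_
    rw [wedgeForm_assoc _ _ (add_comm 1 p) (add_comm 1 (p + 1)), dirDeriv_comm]
  have hA : extD (extD ω) = (-1 : ℝ) • extD (extD ω) := by
    conv_lhs => rw [hS, Finset.sum_comm]
    rw [hS]
    simp only [Finset.smul_sum]
    refine Finset.sum_congr rfl fun i _ => Finset.sum_congr rfl fun j _ => ?_
    rw [wedgeForm_one_left_comm _ (by omega : 1 + 1 = 2), dirDeriv_comm]
    simp
  exact eq_zero_of_eq_neg_one_smul hA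

theorem extD_wedgeForm (h : p + q = n) (h₁ : p + 1 + q = n + 1) (h₂ : p + (q + 1) = n + 1)
    (α : SmoothForm d p) (β : SmoothForm d q) :
    extD (wedgeForm h α β) =
      wedgeForm h₁ (extD α) β + (-1 : ℝ) ^ p • wedgeForm h₂ α (extD β) := by
  simp only [extD_eq, dirDeriv_wedgeForm, map_add, Finset.sum_add_distrib, map_sum,
    LinearMap.sum_apply, Finset.smul_sum]
  congr 1
  · refine Finset.sum_congr rfl fun j _ => ?_
    rw [wedgeForm_assoc]
  · refine Finset.sum_congr rfl fun j _ => ?_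
    rw [← wedgeForm_assoc (add_comm 1 p) h₁, wedgeForm_one_left_comm _ rfl, map_smul,
      LinearMap.smul_apply, wedgeForm_assoc]

theorem eq_zero_of_dirDeriv_time_eq_zero (ω : SmoothForm d p) (hω : dirDeriv (1, 0) ω = 0)
    (h0 : ∀ x v, ω.1 (0, x) v = 0) : ω = 0 := by
  refine SmoothForm.ext_apply fun q v => ?_
  have hd : ∀ t : ℝ, HasDerivAt (fun s : ℝ => ω.1 (s, q.2) v) 0 t := by
    intro t
    have h1 : HasDerivAt (fun s : ℝ => ω.1 (s, q.2) v)
        (fderiv ℝ (fun q => ω.1 q v) (t, q.2) (1, 0)) t :=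
      HasFDerivAt.comp_hasDerivAt (l := fun q => ω.1 q v) (f := fun s => (s, q.2)) t
        (differentiableAt_eval ω v (t, q.2)).hasFDerivAt
        ((hasDerivAt_id t).prodMk (hasDerivAt_const t q.2))
    rwa [← dirDeriv_apply, hω] at h1
  have := is_const_of_deriv_eq_zero (fun t => (hd t).differentiableAt)
    (fun t => (hd t).deriv) q.1 0
  exact this.trans (h0 q.2 v)

theorem wedgeForm_self_three (h : 3 + 3 = n) (α : SmoothForm d 3) : wedgeForm h α α = 0 := by
  have hs : Equiv.Perm.sign (((finCongr h.symm).trans finAddFlip).trans (finCongr h)) = -1 := by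
    subst h
    decide
  refine eq_zero_of_eq_neg_one_smul (SmoothForm.ext_apply fun x v => ?_)
  have hc := wedgeTo_comm h h (α.1 x) (α.1 x)
  rw [hs, Units.val_neg, Units.val_one, Int.cast_neg, Int.cast_one] at hc
  exact DFunLike.congr_fun hc v

theorem wedgeForm_two_three_comm (h : 2 + 3 = n) (h' : 3 + 2 = n) (α : SmoothForm d 2)
    (β : SmoothForm d 3) : wedgeForm h α β = wedgeForm h' β α := by
  have hs : Equiv.Perm.sign (((finCongr h.symm).trans finAddFlip).trans (finCongr h')) = 1 := by
    subst h
    revert h'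
    decide
  refine SmoothForm.ext_apply fun x v => ?_
  have hc := wedgeTo_comm h h' (α.1 x) (β.1 x)
  rw [hs, Units.val_one, Int.cast_one, one_smul] at hc
  exact DFunLike.congr_fun hc v

/-- The twisted Gauss constraint `dB₂ - H ∧ B₁` is conserved in time. -/
theorem dirDeriv_gauss_eq_zero {k : ℕ} (H : SmoothForm d 3) (h : SmoothForm d 2)
    (B₂ : SmoothForm d (k + 3)) (B₁ : SmoothForm d (k + 1)) (e₂ : SmoothForm d (k + 2))
    (e₀ : SmoothForm d k) (X : SmoothForm d (k + 1))
    (hH : dirDeriv (1, 0) H = extD h) (hdH : extD H = 0)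
    (hB₂ : dirDeriv (1, 0) B₂ = extD e₂ + wedgeForm (by omega) h B₁ - wedgeForm (by omega) H e₀)
    (hB₁ : dirDeriv (1, 0) B₁ = extD e₀ + X)
    (hX : wedgeForm (by omega : 2 + (k + 1 + 1) = k + 4) h (extD B₁) =
      wedgeForm (by omega : 3 + (k + 1) = k + 4) H X) :
    dirDeriv (1, 0) (extD B₂ - wedgeForm (by omega : 3 + (k + 1) = k + 3 + 1) H B₁) = 0 := by
  rw [map_sub, dirDeriv_extD, hB₂, dirDeriv_wedgeForm, hH, hB₁, map_sub, map_add, extD_extD,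
    extD_wedgeForm _ (by omega) (by omega) h B₁, extD_wedgeForm _ (by omega) (by omega) H e₀,
    hdH, hX, map_add]
  simp only [map_zero, LinearMap.zero_apply]
  module

theorem wedgeForm_gauss {j : ℕ} (H : SmoothForm d 3) (h : SmoothForm d 2)
    (B : SmoothForm d (j + 1)) (e : SmoothForm d j) (h₁ : 3 + (j + 1) = p)
    (h₂ : 2 + p = n) (h₃ : 2 + (j + 1) = q) (h₄ : 3 + j = q) (h₅ : 3 + q = n) :
    wedgeForm h₂ h (wedgeForm h₁ H B) =
      wedgeForm h₅ H (wedgeForm h₃ h B - wedgeForm h₄ H e) := by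
  rw [map_sub, ← wedgeForm_assoc (rfl : 2 + 3 = 5) (by omega) h₁ h₂,
    ← wedgeForm_assoc (rfl : 3 + 2 = 5) (by omega) h₃ h₅,
    ← wedgeForm_assoc (rfl : 3 + 3 = 6) (by omega) h₄ h₅, wedgeForm_self_three,
    wedgeForm_two_three_comm _ rfl]
  simp

/-- The Gauss laws for the RR-fields hold at all times if they hold initially. -/
theorem extD_eq_wedgeForm_of_initial (H : SmoothForm d 3) (h : SmoothForm d 2)
    (B e : ∀ k, SmoothForm d k) (hH : dirDeriv (1, 0) H = extD h) (hdH : extD H = 0)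
    (hB0 : B 0 = 0) (hdB1 : extD (B 1) = 0) (hB1 : dirDeriv (1, 0) (B 1) = extD (e 0))
    (hB2 : dirDeriv (1, 0) (B 2) = extD (e 1))
    (hB : ∀ k, dirDeriv (1, 0) (B (k + 3)) = extD (e (k + 2)) +
      wedgeForm (by omega) h (B (k + 1)) - wedgeForm (by omega) H (e k))
    (hG : ∀ k x v, (extD (B (k + 2)) -
      wedgeForm (by omega : 3 + k = k + 2 + 1) H (B k)).1 (0, x) v = 0) (k : ℕ) :
    extD (B (k + 2)) = wedgeForm (by omega) H (B k) := by
  induction k using Nat.strong_induction_on with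
  | _ k ih =>
    refine sub_eq_zero.mp (eq_zero_of_dirDeriv_time_eq_zero _ ?_ (hG k))
    match k with
    | 0 =>
      rw [hB0, map_zero, sub_zero, dirDeriv_extD]
      exact (congrArg extD hB2).trans (extD_extD _)
    | m + 1 =>
      obtain ⟨X, hX, hhX⟩ : ∃ X, dirDeriv (1, 0) (B (m + 1)) = extD (e m) + X ∧
          wedgeForm (by omega : 2 + (m + 1 + 1) = m + 4) h (extD (B (m + 1))) =
            wedgeForm (by omega : 3 + (m + 1) = m + 4) H X := by
        match m with
        | 0 => exact ⟨0, hB1.trans (add_zero _).symm, by rw [hdB1, map_zero, map_zero]⟩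
        | 1 =>
          have h2 : extD (B 2) = 0 := (ih 0 (by omega)).trans (by rw [hB0, map_zero])
          exact ⟨0, hB2.trans (add_zero _).symm, by rw [h2, map_zero, map_zero]⟩
        | j + 2 =>
          refine ⟨_, (hB j).trans (add_sub_assoc _ _ _), ?_⟩
          rw [ih (j + 1) (by omega)]
          exact wedgeForm_gauss H h (B (j + 1)) (e j) _ _ _ _ _
      exact dirDeriv_gauss_eq_zero H h (B (m + 3)) (B (m + 1)) (e (m + 2)) (e m) X hH hdH (hB m)
        hX hhX

end SmoothForms

/-- Fix `σ ∈ {0,1}`.  Let `H` (degree 3) and `h` (degree 2) be smooth time-dependent forms on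
`ℝ⁹`, and for each `k` let `B k` (degree `k`) and `e k` (degree `k`, representing
`e_{k-1+1} = e_k`, the electric potential of `B (k+1)`) be smooth time-dependent forms on
`ℝ⁹`, vanishing except when the corresponding RR-degree lies in `{1,…,9}` and is congruent
to `σ` mod 2.  Assume the duality-symmetric NS/RR evolution equations
`∂ₜH = dh` and `∂ₜB_k = d e_{k−1} + h ∧ B_{k−2} − H ∧ e_{k−3}` (terms with negative index
being zero) hold everywhere.  If the Gauß laws `dH(0,·) = 0` and
`dB_k(0,·) = (H ∧ B_{k−2})(0,·)` hold on the Cauchy surface `{t = 0}`, then they hold on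
all of `ℝ × ℝ⁹`.  (Lemma 2.1 of the paper for the NS/RR-fields of type II supergravity;
the Gauß laws are the `H₃`-twisted Bianchi identities underlying Hypothesis K.) -/
theorem nsrr_gauss_first_class (σ : ℕ) (hσ : σ = 0 ∨ σ = 1)
    (H : TForm 9 3) (h : TForm 9 2) (B : ∀ k : ℕ, TForm 9 k) (e : ∀ k : ℕ, TForm 9 k)
    (hHs : H.Smooth) (hhs : h.Smooth)
    (hBs : ∀ k, (B k).Smooth) (hes : ∀ k, (e k).Smooth)
    (hBvan : ∀ k : ℕ, ¬(1 ≤ k ∧ k ≤ 9 ∧ k % 2 = σ) → B k = 0)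
    (hevan : ∀ k : ℕ, ¬(1 ≤ k + 1 ∧ k + 1 ≤ 9 ∧ (k + 1) % 2 = σ) → e k = 0)
    (hevH : ∀ (q : ℝ × Vec 9) (v : Fin 3 → Vec 9), tder H.raw q v = sder h.raw q v)
    (hev1 : ∀ (q : ℝ × Vec 9) (v : Fin 1 → Vec 9),
      tder (B 1).raw q v = sder (e 0).raw q v)
    (hev2 : ∀ (q : ℝ × Vec 9) (v : Fin 2 → Vec 9),
      tder (B 2).raw q v = sder (e 1).raw q v + wedge (h q) (B 0 q) v)
    (hev : ∀ (k : ℕ) (q : ℝ × Vec 9) (v : Fin (k + 3) → Vec 9),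
      tder (B (k + 3)).raw q v
        = sder (e (k + 2)).raw q v
          + ((wedge (h q) (B (k + 1) q)).domDomCongr
              (finCongr (show 2 + (k + 1) = k + 3 by omega))) v
          - ((wedge (H q) (e k q)).domDomCongr
              (finCongr (show 3 + k = k + 3 by omega))) v)
    (hGH : ∀ (x : Vec 9) (v : Fin 4 → Vec 9), sder H.raw (0, x) v = 0)
    (hG1 : ∀ (x : Vec 9) (v : Fin 2 → Vec 9), sder (B 1).raw (0, x) v = 0)
    (hGk : ∀ (k : ℕ) (x : Vec 9) (v : Fin (k + 3) → Vec 9),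
      sder (B (k + 2)).raw (0, x) v
        = ((wedge (H (0, x)) (B k (0, x))).domDomCongr
            (finCongr (show 3 + k = k + 3 by omega))) v) :
    (∀ (t : ℝ) (x : Vec 9) (v : Fin 4 → Vec 9), sder H.raw (t, x) v = 0) ∧
    (∀ (t : ℝ) (x : Vec 9) (v : Fin 2 → Vec 9), sder (B 1).raw (t, x) v = 0) ∧
    (∀ (k : ℕ) (t : ℝ) (x : Vec 9) (v : Fin (k + 3) → Vec 9),
      sder (B (k + 2)).raw (t, x) v
        = ((wedge (H (t, x)) (B k (t, x))).domDomCongr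
            (finCongr (show 3 + k = k + 3 by omega))) v) := by
  let H' : SmoothForm 9 3 := ⟨H, hHs⟩
  let h' : SmoothForm 9 2 := ⟨h, hhs⟩
  let B' : ∀ k, SmoothForm 9 k := fun k => ⟨B k, hBs k⟩
  let e' : ∀ k, SmoothForm 9 k := fun k => ⟨e k, hes k⟩
  have hB0 : B 0 = 0 := hBvan 0 (by omega)
  have hB0' : B' 0 = 0 := SmoothForm.ext_apply fun q v => by
    change B 0 q v = 0
    rw [hB0]
    rfl
  have hH : dirDeriv (1, 0) H' = extD h' := SmoothForm.ext_apply fun q v => by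
    rw [← tder_raw, ← sder_raw]
    exact hevH q v
  have hB1 : dirDeriv (1, 0) (B' 1) = extD (e' 0) := SmoothForm.ext_apply fun q v => by
    rw [← tder_raw, ← sder_raw]
    exact hev1 q v
  have hB2 : dirDeriv (1, 0) (B' 2) = extD (e' 1) := SmoothForm.ext_apply fun q v => by
    have hw : wedge (h q) (B 0 q) = 0 := by
      rw [hB0]
      exact map_zero (wedgeTo rfl (h q))
    rw [← tder_raw, ← sder_raw]
    exact (hev2 q v).trans (by rw [hw]; exact add_zero _)
  have hdH : extD H' = 0 := by
    refine eq_zero_of_dirDeriv_time_eq_zero _ ?_ fun x v => ?_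
    · rw [dirDeriv_extD, hH, extD_extD]
    · rw [← sder_raw]
      exact hGH x v
  have hdB1 : extD (B' 1) = 0 := by
    refine eq_zero_of_dirDeriv_time_eq_zero _ ?_ fun x v => ?_
    · rw [dirDeriv_extD, hB1, extD_extD]
    · rw [← sder_raw]
      exact hG1 x v
  have hB : ∀ k, dirDeriv (1, 0) (B' (k + 3)) = extD (e' (k + 2)) +
      wedgeForm (by omega) h' (B' (k + 1)) - wedgeForm (by omega) H' (e' k) :=
    fun k => SmoothForm.ext_apply fun q v => by
      rw [← tder_raw]
      refine (hev k q v).trans ?_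
      rw [sder_raw (e' (k + 2))]
      rfl
  have hG := extD_eq_wedgeForm_of_initial H' h' B' e' hH hdH hB0' hdB1 hB1 hB2 hB
    fun k x v => sub_eq_zero.mpr ((sder_raw (B' (k + 2)) (0, x) v).symm.trans (hGk k x v))
  refine ⟨fun t x v => ?_, fun t x v => ?_, fun k t x v => ?_⟩
  · rw [sder_raw H', hdH]
    rfl
  · rw [sder_raw (B' 1), hdB1]
    rfl
  · rw [sder_raw (B' (k + 2)), hG k]
    rfl
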